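/- arXiv:math/0008048 — 3 statements merged into one kernel-verified Lean document; each statement's English description precedes it below -/
import Mathlib

section
/- Let π be a nontrivial group (a group with at least two elements). Then the subgroup of the group of bijections of π×π generated by the maps P(a,b) = (b,a) and Q(a,b) = (a⁻¹, b·a⁻¹) is isomorphic to the symmetric group S₃ on three letters. -/
/-- The representative with first entry `1` of a class of triples up to right multiplication. -/
def normalizedTriple {G : Type*} [Group G] (p : G × G) : Fin 3 → G := ![1, p.1, p.2]

/-- The permutation action of `Perm (Fin 3)` on triples up to right multiplication. -/
def permTripleHom (G : Type*) [Group G] : Equiv.Perm (Fin 3) →* Equiv.Perm (G × G) :=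
  MonoidHom.toHomPerm
    { toFun := fun σ p =>
        (normalizedTriple p (σ⁻¹ 1) * (normalizedTriple p (σ⁻¹ 0))⁻¹,
          normalizedTriple p (σ⁻¹ 2) * (normalizedTriple p (σ⁻¹ 0))⁻¹)
      map_one' := by
        funext p
        change _ = p
        simp [normalizedTriple]
      map_mul' := fun σ τ => by
        have key : ∀ (p : G × G) (i : Fin 3), normalizedTriple
            (normalizedTriple p (τ⁻¹ 1) * (normalizedTriple p (τ⁻¹ 0))⁻¹,
              normalizedTriple p (τ⁻¹ 2) * (normalizedTriple p (τ⁻¹ 0))⁻¹) i =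
            normalizedTriple p (τ⁻¹ i) * (normalizedTriple p (τ⁻¹ 0))⁻¹ := by
          intro p i
          fin_cases i
          · exact (mul_inv_cancel _).symm
          · rfl
          · rfl
        funext p
        change _ = (normalizedTriple (_, _) (σ⁻¹ 1) * (normalizedTriple (_, _) (σ⁻¹ 0))⁻¹,
          normalizedTriple (_, _) (σ⁻¹ 2) * (normalizedTriple (_, _) (σ⁻¹ 0))⁻¹)
        simp only [key, mul_inv_rev, Equiv.Perm.mul_apply]
        simp }

theorem permTripleHom_apply {G : Type*} [Group G] (σ : Equiv.Perm (Fin 3)) (p : G × G) :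
    permTripleHom G σ p =
      (normalizedTriple p (σ⁻¹ 1) * (normalizedTriple p (σ⁻¹ 0))⁻¹,
        normalizedTriple p (σ⁻¹ 2) * (normalizedTriple p (σ⁻¹ 0))⁻¹) :=
  rfl

theorem permTripleHom_injective (G : Type*) [Group G] [Nontrivial G] :
    Function.Injective (permTripleHom G) := by
  rw [injective_iff_map_eq_one]
  intro σ hσ
  obtain ⟨c, hc⟩ := exists_ne (1 : G)
  have h₁ := permTripleHom_apply σ (c, 1)
  have h₂ := permTripleHom_apply σ (1, c)
  rw [hσ, Equiv.Perm.one_apply, Prod.mk.injEq] at h₁ h₂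
  have h01 : σ⁻¹ 0 ≠ σ⁻¹ 1 := by simp
  have h02 : σ⁻¹ 0 ≠ σ⁻¹ 2 := by simp
  have h12 : σ⁻¹ 1 ≠ σ⁻¹ 2 := by simp
  rw [← inv_eq_one]
  suffices h : σ⁻¹ 0 = 0 ∧ σ⁻¹ 1 = 1 ∧ σ⁻¹ 2 = 2 by
    ext i
    fin_cases i <;> simp [h]
  generalize σ⁻¹ 0 = i at *
  generalize σ⁻¹ 1 = j at *
  generalize σ⁻¹ 2 = k at *
  fin_cases i <;> fin_cases j <;> fin_cases k <;>
    simp [normalizedTriple, hc, hc.symm] at h01 h02 h12 h₁ h₂ ⊢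

theorem closure_adjacent_swaps_fin_three :
    Subgroup.closure {Equiv.swap (1 : Fin 3) 2, Equiv.swap (0 : Fin 3) 1} = ⊤ := by
  rw [eq_top_iff]
  intro σ _
  have h : σ ∈ Submonoid.closure
      (Set.range fun i : Fin 2 => Equiv.swap i.castSucc i.succ) := by
    rw [Equiv.Perm.mclosure_swap_castSucc_succ]
    trivial
  refine (Submonoid.closure_le (S := (Subgroup.closure _).toSubmonoid)).2 ?_ h
  rintro _ ⟨i, rfl⟩
  apply Subgroup.subset_closure
  fin_cases i
  · exact Or.inr rfl
  · exact Or.inl rfl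

/-- For a nontrivial group `π`, the subgroup of bijections of `π × π`
generated by `P (a,b) = (b,a)` and `Q (a,b) = (a⁻¹, b·a⁻¹)` is isomorphic to the
symmetric group `S₃` on three letters. -/
theorem stmt_1 (π : Type*) [Group π] [Nontrivial π]
    (P Q : Equiv.Perm (π × π))
    (hP : ∀ a b : π, P (a, b) = (b, a))
    (hQ : ∀ a b : π, Q (a, b) = (a⁻¹, b * a⁻¹)) :
    Nonempty ((Subgroup.closure {P, Q} : Subgroup (Equiv.Perm (π × π))) ≃* Equiv.Perm (Fin 3)) := by
  have hP' : permTripleHom π (Equiv.swap 1 2) = P := by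
    ext1 ⟨a, b⟩
    rw [hP, permTripleHom_apply, Equiv.swap_inv, Equiv.swap_apply_left, Equiv.swap_apply_right,
      Equiv.swap_apply_of_ne_of_ne (by decide) (by decide)]
    simp [normalizedTriple]
  have hQ' : permTripleHom π (Equiv.swap 0 1) = Q := by
    ext1 ⟨a, b⟩
    rw [hQ, permTripleHom_apply, Equiv.swap_inv, Equiv.swap_apply_left, Equiv.swap_apply_right,
      Equiv.swap_apply_of_ne_of_ne (by decide) (by decide)]
    simp [normalizedTriple]
  have hrange : (permTripleHom π).range = Subgroup.closure {P, Q} := by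
    rw [MonoidHom.range_eq_map, ← closure_adjacent_swaps_fin_three, MonoidHom.map_closure,
      Set.image_pair, hP', hQ']
  rw [← hrange]
  exact ⟨(MonoidHom.ofInjective (permTripleHom_injective π)).symm⟩
end

section
/- Let π be a group and let R be the additive subgroup of ℤ[π×π] generated by all BC elements (a,b) + (b,a), all SC elements (a,b) + (a⁻¹, b·a⁻¹), and all FR elements (a,1) − (a,a). Then for every a ∈ π and all integers n, m with n ≡ m (mod 2), the element n·(a,1) + m·(a,a) lies in R. -/
/-- The basis element of the integral group ring `ℤ[π × π]` corresponding to the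
pair `(a, b)`. -/
noncomputable def pairElt (π : Type*) [Group π] (a b : π) : MonoidAlgebra ℤ (π × π) :=
  MonoidAlgebra.of ℤ (π × π) (a, b)

/-- The additive subgroup `R` of `ℤ[π × π]` generated by the BC elements
`(a,b) + (b,a)`, the SC elements `(a,b) + (a⁻¹, b·a⁻¹)` and the FR elements
`(a,1) − (a,a)`. -/
noncomputable def relSubgroup (π : Type*) [Group π] : AddSubgroup (MonoidAlgebra ℤ (π × π)) :=
  AddSubgroup.closure
    ({x | ∃ a b : π, x = pairElt π a b + pairElt π b a} ∪
     {x | ∃ a b : π, x = pairElt π a b + pairElt π a⁻¹ (b * a⁻¹)} ∪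
     {x | ∃ a : π, x = pairElt π a 1 - pairElt π a a})

/-- For every `a ∈ π` and all integers `n ≡ m (mod 2)`, the element
`n·(a,1) + m·(a,a)` lies in `R`. -/
theorem stmt_5 (π : Type*) [Group π] (a : π) (n m : ℤ) (h : n ≡ m [ZMOD 2]) :
    n • pairElt π a 1 + m • pairElt π a a ∈ relSubgroup π := by
  obtain ⟨k, hk⟩ := h.dvd
  have hFR : pairElt π a 1 - pairElt π a a ∈ relSubgroup π :=
    AddSubgroup.subset_closure (Or.inr ⟨a, rfl⟩)
  have hBC : pairElt π a a + pairElt π a a ∈ relSubgroup π :=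
    AddSubgroup.subset_closure (Or.inl (Or.inl ⟨a, a, rfl⟩))
  obtain rfl : m = n + 2 * k := by lia
  have key : n • pairElt π a 1 + (n + 2 * k) • pairElt π a a =
      n • (pairElt π a 1 - pairElt π a a) + (n + k) • (pairElt π a a + pairElt π a a) := by
    module
  rw [key]
  exact add_mem (zsmul_mem hFR n) (zsmul_mem hBC (n + k))
end

section
/- Let π be a group. Let K be the additive subgroup of the integral group ring ℤ[π×π×π] generated by the elements (a,b,c) − (a·g, b·g, c·g), (a,b,c) + (b,a,c), (a,b,c) + (a,c,b), and (a,a,b) − (a,b,b), for all a, b, c, g ∈ π. Let R be the additive subgroup of ℤ[π×π] generated by the elements (a,b) + (b,a), (a,b) + (a⁻¹, b·a⁻¹), and (a,1) − (a,a), for all a, b ∈ π. Let ψ : ℤ[π×π×π] → ℤ[π×π] be the ℤ-linear map determined on basis elements by ψ(a,b,c) = (b·a⁻¹, c·a⁻¹). Then ψ(K) ⊆ R, and the induced homomorphism of quotient groups ℤ[π×π×π]/K → ℤ[π×π]/R is an isomorphism of abelian groups. -/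
/-- The basis element of the integral group ring `ℤ[π × π × π]` corresponding to the
triple `(a, b, c)`. -/
noncomputable def tripleElt (π : Type*) [Group π] (a b c : π) : MonoidAlgebra ℤ (π × π × π) :=
  MonoidAlgebra.of ℤ (π × π × π) (a, b, c)

/-- The additive subgroup `K` of `ℤ[π × π × π]` generated by the elements
`(a,b,c) − (a·g, b·g, c·g)`, `(a,b,c) + (b,a,c)`, `(a,b,c) + (a,c,b)` and
`(a,a,b) − (a,b,b)`. -/
noncomputable def Ksubgroup (π : Type*) [Group π] : AddSubgroup (MonoidAlgebra ℤ (π × π × π)) :=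
  AddSubgroup.closure
    ({x | ∃ a b c g : π, x = tripleElt π a b c - tripleElt π (a * g) (b * g) (c * g)} ∪
     {x | ∃ a b c : π, x = tripleElt π a b c + tripleElt π b a c} ∪
     {x | ∃ a b c : π, x = tripleElt π a b c + tripleElt π a c b} ∪
     {x | ∃ a b : π, x = tripleElt π a a b - tripleElt π a b b})

/-- The ring homomorphism `ℤ[π × π] → ℤ[π × π × π]` with `(a, b) ↦ (1, a, b)`. -/
noncomputable def unitTripleHom (π : Type*) [Group π] :
    MonoidAlgebra ℤ (π × π) →+* MonoidAlgebra ℤ (π × π × π) :=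
  MonoidAlgebra.mapDomainRingHom ℤ (MonoidHom.inr π (π × π))

section

variable {π : Type*} [Group π]

@[simp]
theorem unitTripleHom_pairElt (a b : π) :
    unitTripleHom π (pairElt π a b) = tripleElt π 1 a b := by
  simp [unitTripleHom, pairElt, tripleElt]

namespace Ksubgroup

theorem sub_mul_right_mem (a b c g : π) :
    tripleElt π a b c - tripleElt π (a * g) (b * g) (c * g) ∈ Ksubgroup π :=
  AddSubgroup.subset_closure (Or.inl (Or.inl (Or.inl ⟨a, b, c, g, rfl⟩)))

theorem add_swap_left_mem (a b c : π) :
    tripleElt π a b c + tripleElt π b a c ∈ Ksubgroup π :=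
  AddSubgroup.subset_closure (Or.inl (Or.inl (Or.inr ⟨a, b, c, rfl⟩)))

theorem add_swap_right_mem (a b c : π) :
    tripleElt π a b c + tripleElt π a c b ∈ Ksubgroup π :=
  AddSubgroup.subset_closure (Or.inl (Or.inr ⟨a, b, c, rfl⟩))

theorem diag_sub_diag_mem (a b : π) :
    tripleElt π a a b - tripleElt π a b b ∈ Ksubgroup π :=
  AddSubgroup.subset_closure (Or.inr ⟨a, b, rfl⟩)

end Ksubgroup

namespace relSubgroup

theorem add_swap_mem (a b : π) : pairElt π a b + pairElt π b a ∈ relSubgroup π :=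
  AddSubgroup.subset_closure (Or.inl (Or.inl ⟨a, b, rfl⟩))

theorem add_inv_mem (a b : π) :
    pairElt π a b + pairElt π a⁻¹ (b * a⁻¹) ∈ relSubgroup π :=
  AddSubgroup.subset_closure (Or.inl (Or.inr ⟨a, b, rfl⟩))

theorem sub_diag_mem (a : π) : pairElt π a 1 - pairElt π a a ∈ relSubgroup π :=
  AddSubgroup.subset_closure (Or.inr ⟨a, rfl⟩)

end relSubgroup

theorem Ksubgroup_le_comap
    (ψ : MonoidAlgebra ℤ (π × π × π) →+ MonoidAlgebra ℤ (π × π))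
    (hψ : ∀ a b c : π, ψ (tripleElt π a b c) = pairElt π (b * a⁻¹) (c * a⁻¹)) :
    Ksubgroup π ≤ (relSubgroup π).comap ψ := by
  refine (AddSubgroup.closure_le _).2 ?_
  rintro _ (((⟨a, b, c, g, rfl⟩ | ⟨a, b, c, rfl⟩) | ⟨a, b, c, rfl⟩) | ⟨a, b, rfl⟩) <;>
    simp only [SetLike.mem_coe, AddSubgroup.mem_comap, map_add, map_sub, hψ]
  · simp [mul_assoc, zero_mem]
  · simpa [mul_assoc] using relSubgroup.add_inv_mem (b * a⁻¹) (c * a⁻¹)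
  · exact relSubgroup.add_swap_mem _ _
  · rw [mul_inv_cancel]
    have h := sub_mem (sub_mem (relSubgroup.add_swap_mem (b * a⁻¹) 1)
      (relSubgroup.sub_diag_mem (b * a⁻¹))) (relSubgroup.add_swap_mem (b * a⁻¹) (b * a⁻¹))
    convert h using 1
    abel

theorem relSubgroup_le_comap_unitTripleHom :
    relSubgroup π ≤ (Ksubgroup π).comap (unitTripleHom π).toAddMonoidHom := by
  refine (AddSubgroup.closure_le _).2 ?_
  rintro _ ((⟨a, b, rfl⟩ | ⟨a, b, rfl⟩) | ⟨a, rfl⟩) <;>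
    simp only [SetLike.mem_coe, AddSubgroup.mem_comap, RingHom.toAddMonoidHom_eq_coe,
      AddMonoidHom.coe_coe, map_add, map_sub, unitTripleHom_pairElt]
  · exact Ksubgroup.add_swap_right_mem _ _ _
  · have h := sub_mem (Ksubgroup.add_swap_left_mem 1 a b)
      (Ksubgroup.sub_mul_right_mem a 1 b a⁻¹)
    rw [mul_inv_cancel, one_mul] at h
    convert h using 1
    abel
  · have h := sub_mem (add_mem (Ksubgroup.add_swap_right_mem 1 a 1)
      (Ksubgroup.diag_sub_diag_mem 1 a)) (Ksubgroup.add_swap_left_mem 1 1 a)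
    convert h using 1
    abel

theorem apply_unitTripleHom
    (ψ : MonoidAlgebra ℤ (π × π × π) →ₗ[ℤ] MonoidAlgebra ℤ (π × π))
    (hψ : ∀ a b c : π, ψ (tripleElt π a b c) = pairElt π (b * a⁻¹) (c * a⁻¹))
    (x : MonoidAlgebra ℤ (π × π)) : ψ (unitTripleHom π x) = x := by
  induction x using MonoidAlgebra.induction_on with
  | of p =>
    change ψ (unitTripleHom π (pairElt π p.1 p.2)) = pairElt π p.1 p.2
    simp [hψ]
  | add x y hx hy => simp [hx, hy]
  | smul r x hx => rw [map_zsmul, map_zsmul, hx]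

theorem unitTripleHom_apply_sub_mem
    (ψ : MonoidAlgebra ℤ (π × π × π) →ₗ[ℤ] MonoidAlgebra ℤ (π × π))
    (hψ : ∀ a b c : π, ψ (tripleElt π a b c) = pairElt π (b * a⁻¹) (c * a⁻¹))
    (x : MonoidAlgebra ℤ (π × π × π)) : x - unitTripleHom π (ψ x) ∈ Ksubgroup π := by
  induction x using MonoidAlgebra.induction_on with
  | of p =>
    change tripleElt π p.1 p.2.1 p.2.2 -
      unitTripleHom π (ψ (tripleElt π p.1 p.2.1 p.2.2)) ∈ Ksubgroup π
    simpa [hψ] using Ksubgroup.sub_mul_right_mem p.1 p.2.1 p.2.2 p.1⁻¹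
  | add x y hx hy =>
    rw [map_add, map_add, add_sub_add_comm]
    exact add_mem hx hy
  | smul r x hx =>
    rw [map_zsmul, map_zsmul, ← smul_sub]
    exact zsmul_mem hx r

end

/-- The ℤ-linear map `ψ : ℤ[π×π×π] → ℤ[π×π]` determined on basis elements
by `ψ (a,b,c) = (b·a⁻¹, c·a⁻¹)` satisfies `ψ(K) ⊆ R`, and the induced homomorphism of
quotient groups `ℤ[π×π×π]/K → ℤ[π×π]/R` is an isomorphism of abelian groups. -/
theorem stmt_8 (π : Type*) [Group π]
    (ψ : MonoidAlgebra ℤ (π × π × π) →ₗ[ℤ] MonoidAlgebra ℤ (π × π))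
    (hψ : ∀ a b c : π, ψ (tripleElt π a b c) = pairElt π (b * a⁻¹) (c * a⁻¹)) :
    (∀ x ∈ Ksubgroup π, ψ x ∈ relSubgroup π) ∧
    ∃ e : (MonoidAlgebra ℤ (π × π × π) ⧸ Ksubgroup π) ≃+ (MonoidAlgebra ℤ (π × π) ⧸ relSubgroup π),
      ∀ x : MonoidAlgebra ℤ (π × π × π),
        e (QuotientAddGroup.mk' (Ksubgroup π) x) = QuotientAddGroup.mk' (relSubgroup π) (ψ x) := by
  have hK : Ksubgroup π ≤ (relSubgroup π).comap ψ.toAddMonoidHom :=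
    Ksubgroup_le_comap ψ.toAddMonoidHom hψ
  refine ⟨fun x hx => hK hx, AddMonoidHom.toAddEquiv
    (QuotientAddGroup.map _ _ ψ.toAddMonoidHom hK)
    (QuotientAddGroup.map _ _ (unitTripleHom π).toAddMonoidHom
      relSubgroup_le_comap_unitTripleHom) ?_ ?_, fun x => rfl⟩
  · refine QuotientAddGroup.addMonoidHom_ext _ (DFunLike.ext _ _ fun x => ?_)
    refine QuotientAddGroup.eq.2 ?_
    rw [neg_add_eq_sub]
    exact unitTripleHom_apply_sub_mem ψ hψ x
  · refine QuotientAddGroup.addMonoidHom_ext _ (DFunLike.ext _ _ fun x => ?_)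
    exact congrArg (QuotientAddGroup.mk' (relSubgroup π)) (apply_unitTripleHom ψ hψ x)
end
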